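/- For every integer n ≥ 1, setting k = 2n and c = 4n+1, one has (2k−1)/2 + (1/2)·∑_{l=0}^{k-1} (2l+1)·2^{k−l−1}·C(k+l, 2l+1) + ∑_{p=0}^{n-1} (4p+3)·2^{n−p−1}·C(n+p, 2p+1) = (1/27)·((3c−4)·2^{c−2} + (3c+4)·2^{(c−1)/2} + 18c − 38). (The left-hand side is the total number of sign changes, summed over all two-bridge knots with crossing number c ≡ 1 (mod 4).) -/

import Mathlib

def auxS (f : ℕ → ℚ) (k : ℕ) : ℚ :=
  ∑ l ∈ Finset.range k, f l * 2 ^ (k - l - 1) * (Nat.choose (k + l) (2 * l + 1) : ℚ)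

def auxT (f : ℕ → ℚ) (k : ℕ) : ℚ :=
  ∑ l ∈ Finset.range (k + 1), f l * 2 ^ (k - l) * (Nat.choose (k + l) (2 * l) : ℚ)

lemma auxS_succ (f : ℕ → ℚ) (k : ℕ) : auxS f (k + 1) = auxT f k + 2 * auxS f k := by
  have h : 2 * auxS f k = ∑ l ∈ Finset.range (k + 1),
      f l * 2 ^ (k - l) * (Nat.choose (k + l) (2 * l + 1) : ℚ) := by
    rw [Finset.sum_range_succ, Nat.choose_eq_zero_of_lt (by omega : k + k < 2 * k + 1)]
    simp only [auxS, Finset.mul_sum, Nat.cast_zero, mul_zero, add_zero]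
    refine Finset.sum_congr rfl fun l hl => ?_
    have hl' := Finset.mem_range.mp hl
    obtain ⟨m, hm⟩ : ∃ m, k - l = m + 1 := ⟨k - l - 1, by omega⟩
    rw [hm, Nat.add_sub_cancel]
    ring
  rw [h, auxT, auxS, ← Finset.sum_add_distrib]
  refine Finset.sum_congr rfl fun l _ => ?_
  rw [show k + 1 + l = (k + l) + 1 by omega, Nat.choose_succ_succ,
    show k + 1 - l - 1 = k - l by omega]
  push_cast
  ring

lemma auxT_succ (f : ℕ → ℚ) (k : ℕ) :
    auxT f (k + 1) = 2 * auxT f k + auxS (fun l => f (l + 1)) (k + 1) := by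
  have h : 2 * auxT f k = ∑ l ∈ Finset.range (k + 1 + 1),
      f l * 2 ^ (k + 1 - l) * (Nat.choose (k + l) (2 * l) : ℚ) := by
    rw [Finset.sum_range_succ,
      Nat.choose_eq_zero_of_lt (by omega : k + (k + 1) < 2 * (k + 1))]
    simp only [auxT, Finset.mul_sum, Nat.cast_zero, mul_zero, add_zero]
    refine Finset.sum_congr rfl fun l hl => ?_
    have hl' := Finset.mem_range.mp hl
    rw [show k + 1 - l = (k - l) + 1 by omega]
    ring
  rw [h, auxT, auxS, Finset.sum_range_succ', Finset.sum_range_succ' _ (k + 1)]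
  rw [add_right_comm (Finset.sum _ _), ← Finset.sum_add_distrib]
  congr 1
  · refine Finset.sum_congr rfl fun l _ => ?_
    rw [show k + 1 + (l + 1) = (k + 1 + l) + 1 by omega,
      show 2 * (l + 1) = (2 * l + 1) + 1 by omega, Nat.choose_succ_succ,
      show k + (l + 1) = k + 1 + l by omega,
      show k + 1 - (l + 1) = k + 1 - l - 1 by omega]
    push_cast
    ring
  · simp

lemma aux_one (k : ℕ) : auxS (fun _ => 1) k = (4 ^ k - 1) / 3 ∧
    auxT (fun _ => 1) k = (2 * 4 ^ k + 1) / 3 := by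
  induction k with
  | zero => constructor <;> norm_num [auxS, auxT]
  | succ k ih =>
    rw [auxT_succ, auxS_succ, ih.1, ih.2]
    constructor <;> ring

lemma auxS_lin (a b : ℚ) (k : ℕ) : auxS (fun l => a * l + b) k =
    a * auxS (fun l => (l : ℚ)) k + b * auxS (fun _ => 1) k := by
  simp only [auxS, Finset.mul_sum, ← Finset.sum_add_distrib]
  exact Finset.sum_congr rfl fun l _ => by ring

lemma aux_id (k : ℕ) :
    auxS (fun l => (l : ℚ)) k = ((3 * k - 5) * 4 ^ k + 3 * k + 5) / 27 ∧
    auxT (fun l => (l : ℚ)) k = ((6 * k + 2) * 4 ^ k - 3 * k - 2) / 27 := by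
  induction k with
  | zero => constructor <;> norm_num [auxS, auxT]
  | succ k ih =>
    have h : auxS (fun l => ((l + 1 : ℕ) : ℚ)) (k + 1) =
        1 * auxS (fun l => (l : ℚ)) (k + 1) + 1 * auxS (fun _ => 1) (k + 1) := by
      rw [← auxS_lin]; congr 1; funext l; push_cast; ring
    rw [auxT_succ, h, auxS_succ, ih.1, ih.2, (aux_one (k + 1)).1]
    push_cast
    constructor <;> ring

/-- Total "sign change" for crossing number `c ≡ 1 (mod 4)`: for every `n ≥ 1`,
with `k = 2n` and `c = 4n+1`,
`(2k-1)/2 + (1/2) * ∑_{l=0}^{k-1} (2l+1) * 2^(k-l-1) * C(k+l, 2l+1)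
  + ∑_{p=0}^{n-1} (4p+3) * 2^(n-p-1) * C(n+p, 2p+1)
  = (1/27) * ((3c-4) * 2^(c-2) + (3c+4) * 2^((c-1)/2) + 18c - 38)`. -/
theorem total_sign_change_one_mod_four (n k c : ℕ) (hn : 1 ≤ n)
    (hk : k = 2 * n) (hc : c = 4 * n + 1) :
    (2 * (k : ℚ) - 1) / 2
      + (1 / 2) * ∑ l ∈ Finset.range k,
          (2 * (l : ℚ) + 1) * 2 ^ (k - l - 1) * (Nat.choose (k + l) (2 * l + 1) : ℚ)
      + ∑ p ∈ Finset.range n,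
          (4 * (p : ℚ) + 3) * 2 ^ (n - p - 1) * (Nat.choose (n + p) (2 * p + 1) : ℚ)
    = (1 / 27) * ((3 * (c : ℚ) - 4) * 2 ^ (c - 2)
        + (3 * (c : ℚ) + 4) * 2 ^ ((c - 1) / 2) + 18 * (c : ℚ) - 38) := by
  have h1 := auxS_lin 2 1 k
  have h2 := auxS_lin 4 3 n
  rw [(aux_id _).1, (aux_one _).1] at h1 h2
  simp only [auxS] at h1 h2
  rw [h1, h2]
  subst hk hc
  obtain ⟨m, rfl⟩ : ∃ m, n = m + 1 := ⟨n - 1, by omega⟩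
  rw [show 4 * (m + 1) + 1 - 2 = 4 * m + 3 by omega,
    show (4 * (m + 1) + 1 - 1) / 2 = 2 * m + 2 by omega]
  have e1 : (4 : ℚ) ^ (m + 1) = 4 * (2 ^ m) ^ 2 := by
    rw [← pow_mul, mul_comm m 2, pow_mul, pow_succ]; norm_num; ring
  have e2 : (4 : ℚ) ^ (2 * (m + 1)) = 16 * (2 ^ m) ^ 4 := by
    rw [mul_comm, pow_mul, e1]; ring
  have e3 : (2 : ℚ) ^ (4 * m + 3) = 8 * (2 ^ m) ^ 4 := by ring
  have e4 : (2 : ℚ) ^ (2 * m + 2) = 4 * (2 ^ m) ^ 2 := by ring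
  rw [e1, e2, e3, e4]
  push_cast
  ring
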